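/- arXiv:0906.0870 — 4 statements merged into one kernel-verified Lean document; each statement's English description precedes it below -/
import Mathlib

section
/- Let p be an odd prime, F a field of characteristic p, and G a finite group. Suppose c is a central element of G of order p, b is an element of G of order p, and a ∈ G satisfies a⁻¹ba = bc. Set B̂ = Σ_{i=0}^{p-1} bⁱ in FG. Then (aB̂)³ = 0, and consequently 1 + aB̂ is a unit of FG satisfying (1 + aB̂)^p = 1. -/
open MonoidAlgebra

theorem aux_hat_absorb {R : Type*} [Ring R] (x : R) (p : ℕ) (hx : x ^ p = 1) (i : ℕ) :
    x ^ i * ∑ j ∈ Finset.range p, x ^ j = ∑ j ∈ Finset.range p, x ^ j := by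
  have h1 : x * ∑ j ∈ Finset.range p, x ^ j = ∑ j ∈ Finset.range p, x ^ j := by
    have h := mul_geom_sum x p
    rw [hx, sub_self, sub_mul, one_mul, sub_eq_zero] at h
    exact h
  induction i with
  | zero => simp
  | succ k ih => rw [pow_succ, mul_assoc, h1, ih]

theorem aux_cube {R : Type*} [Ring R] (p : ℕ) [CharP R p] (a b c : R)
    (hb : b ^ p = 1) (hc : c ^ p = 1) (hcen : ∀ x, c * x = x * c)
    (hab : b * a = a * (c * b)) :
    (a * ∑ i ∈ Finset.range p, b ^ i) ^ 3 = 0 := by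
  have hBB := aux_hat_absorb b p hb
  have hCC := aux_hat_absorb c p hc
  have hpow : ∀ i : ℕ, b ^ i * a = a * (c ^ i * b ^ i) := by
    intro i
    rw [← (show Commute c b from hcen b).mul_pow]
    exact ((show SemiconjBy a (c * b) b from hab.symm).pow_right i).eq.symm
  have hCx : ∀ x, (∑ i ∈ Finset.range p, c ^ i) * x = x * ∑ i ∈ Finset.range p, c ^ i := by
    intro x
    exact (Commute.sum_left _ _ _ fun i _ => (show Commute c x from hcen x).pow_left i)
  have hBaB : (∑ i ∈ Finset.range p, b ^ i) * a * (∑ i ∈ Finset.range p, b ^ i)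
      = a * ((∑ i ∈ Finset.range p, c ^ i) * ∑ i ∈ Finset.range p, b ^ i) := by
    rw [Finset.sum_mul, Finset.sum_mul, Finset.sum_mul, Finset.mul_sum]
    refine Finset.sum_congr rfl fun i _ => ?_
    rw [hpow, mul_assoc, mul_assoc, hBB]
  have hC2 : (∑ i ∈ Finset.range p, c ^ i) * (∑ i ∈ Finset.range p, c ^ i) = 0 := by
    conv_lhs => rw [Finset.sum_mul]
    rw [Finset.sum_congr rfl fun i _ => hCC i]
    simp
  generalize (∑ i ∈ Finset.range p, b ^ i) = B at *
  generalize (∑ i ∈ Finset.range p, c ^ i) = C at *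
  calc (a * B) ^ 3 = a * (B * a * B) * a * B := by noncomm_ring
    _ = a * a * C * (B * a * B) := by conv_lhs => rw [hBaB]
                                      simp only [mul_assoc]
    _ = a * a * (C * a) * C * B := by rw [hBaB]; noncomm_ring
    _ = a * a * a * (C * C) * B := by rw [hCx a]; noncomm_ring
    _ = 0 := by rw [hC2]; simp

/-- If `c` is central of order `p`, `b` has order `p` and `a⁻¹ b a = b c`, then
`(aB̂)³ = 0`, so `1 + aB̂` is a unit of `FG` with `(1 + aB̂)^p = 1`. -/
theorem aB_cube_zero (p : ℕ) [Fact p.Prime] (hp : Odd p)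
    (F : Type*) [Field F] [CharP F p]
    (G : Type*) [Group G] [Finite G]
    (a b c : G) (hc : c ∈ Subgroup.center G)
    (hco : orderOf c = p) (hbo : orderOf b = p)
    (hab : a⁻¹ * b * a = b * c) :
    (MonoidAlgebra.of F G a * ∑ i ∈ Finset.range p, MonoidAlgebra.of F G (b ^ i)) ^ 3 = 0 ∧
    IsUnit (1 + MonoidAlgebra.of F G a *
      ∑ i ∈ Finset.range p, MonoidAlgebra.of F G (b ^ i)) ∧
    (1 + MonoidAlgebra.of F G a *
      ∑ i ∈ Finset.range p, MonoidAlgebra.of F G (b ^ i)) ^ p = 1 := by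
  have hprime : p.Prime := Fact.out
  have : CharP (MonoidAlgebra F G) p :=
    charP_of_injective_algebraMap (algebraMap F (MonoidAlgebra F G)).injective p
  have h3 : (MonoidAlgebra.of F G a *
      ∑ i ∈ Finset.range p, MonoidAlgebra.of F G (b ^ i)) ^ 3 = 0 := by
    simp only [map_pow]
    refine aux_cube p _ _ (MonoidAlgebra.of F G c) ?_ ?_ ?_ ?_
    · rw [← map_pow, ← hbo, pow_orderOf_eq_one, map_one]
    · rw [← map_pow, ← hco, pow_orderOf_eq_one, map_one]
    · intro x
      induction x using MonoidAlgebra.induction_on with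
      | of g => rw [← map_mul, ← map_mul, Subgroup.mem_center_iff.mp hc g]
      | add x y hx hy => rw [mul_add, add_mul, hx, hy]
      | smul r x hx => rw [mul_smul_comm, smul_mul_assoc, hx]
    · rw [← map_mul, ← map_mul, ← map_mul, ← Subgroup.mem_center_iff.mp hc b, ← hab]
      congr 1
      group
  generalize (MonoidAlgebra.of F G a *
      ∑ i ∈ Finset.range p, MonoidAlgebra.of F G (b ^ i)) = x at *
  have hp3 : 3 ≤ p := by
    have := hprime.two_le
    obtain ⟨k, hk⟩ := hp
    omega
  refine ⟨h3, IsNilpotent.isUnit_one_add ⟨3, h3⟩, ?_⟩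
  rw [add_pow_char_of_commute p (Commute.one_left x), one_pow, pow_eq_zero_of_le hp3 h3,
    add_zero]
end

section
/- Let p be an odd prime, F a field of characteristic p, and G a finite group. Suppose c is a central element of G of order p, b is an element of G of order p with b ∉ ⟨c⟩, and a ∈ G satisfies a⁻¹ba = bc. Set B̂ = Σ_{i=0}^{p-1} bⁱ and Ĉ = Σ_{j=0}^{p-1} cʲ in FG. Then ((1 + aB̂)b)^p = 1 + Ĉ(aB̂), and this element is not equal to 1. -/
open MonoidAlgebra

theorem aux_ring_pow {R : Type*} [Ring R] (p : ℕ) (hp : Odd p) (hpR : (p : R) = 0)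
    (A b c : R) (hcA : c * A = A * c) (hcb : c * b = b * c)
    (hcp : c ^ p = 1) (hbp : b ^ p = 1) (hba : b * A = A * b * c) :
    ((1 + A * ∑ i ∈ Finset.range p, b ^ i) * b) ^ p =
      1 + (∑ j ∈ Finset.range p, c ^ j) * (A * ∑ i ∈ Finset.range p, b ^ i) := by
  have hBb : (∑ i ∈ Finset.range p, b ^ i) * b = ∑ i ∈ Finset.range p, b ^ i := by
    have h := geom_sum_mul b p
    rw [hbp, sub_self, mul_sub, mul_one, sub_eq_zero] at h
    exact h
  have hbB : b * (∑ i ∈ Finset.range p, b ^ i) = ∑ i ∈ Finset.range p, b ^ i := by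
    have h := mul_geom_sum b p
    rw [hbp, sub_self, sub_mul, one_mul, sub_eq_zero] at h
    exact h
  have hcC : c * (∑ i ∈ Finset.range p, c ^ i) = ∑ i ∈ Finset.range p, c ^ i := by
    have h := mul_geom_sum c p
    rw [hcp, sub_self, sub_mul, one_mul, sub_eq_zero] at h
    exact h
  have hcB : c * (∑ i ∈ Finset.range p, b ^ i) = (∑ i ∈ Finset.range p, b ^ i) * c :=
    Commute.sum_right _ _ _ (fun i _ => Commute.pow_right hcb i)
  have hCA : (∑ i ∈ Finset.range p, c ^ i) * A = A * (∑ i ∈ Finset.range p, c ^ i) :=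
    Commute.sum_left _ _ _ (fun i _ => Commute.pow_left hcA i)
  obtain ⟨x, hx⟩ : ∃ x, x = A * ∑ i ∈ Finset.range p, b ^ i := ⟨_, rfl⟩
  have hxb : x * b = x := by rw [hx, mul_assoc, hBb]
  have hbx : b * x = c * x := by
    rw [hx, ← mul_assoc, hba, mul_assoc, hcB, ← mul_assoc, mul_assoc A b, hbB, mul_assoc, ← hcB,
      ← mul_assoc, ← hcA, mul_assoc]
  have hbix : ∀ i : ℕ, b ^ i * x = c ^ i * x := by
    intro i
    induction i with
    | zero => simp
    | succ n ih =>
      have h : b ^ n * c = c * b ^ n := (Commute.pow_right hcb n).symm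
      rw [pow_succ, mul_assoc, hbx, ← mul_assoc, h, mul_assoc, ih, ← mul_assoc, ← pow_succ']
  have hBx : (∑ i ∈ Finset.range p, b ^ i) * x = (∑ i ∈ Finset.range p, c ^ i) * x := by
    simp only [Finset.sum_mul, hbix]
  have hxx : x * x = (∑ i ∈ Finset.range p, c ^ i) * (A * x) := by
    nth_rewrite 1 [hx]
    rw [mul_assoc, hBx, ← mul_assoc, ← hCA, mul_assoc]
  have hcxx : c * (x * x) = x * x := by
    rw [hxx, ← mul_assoc, hcC]
  have hcixx : ∀ i : ℕ, c ^ i * (x * x) = x * x := by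
    intro i
    induction i with
    | zero => simp
    | succ n ih => rw [pow_succ, mul_assoc, hcxx, ih]
  have hxxx : x * x * x = 0 := by
    rw [hxx, ← mul_assoc, hCA, mul_assoc, mul_assoc, Finset.sum_mul]
    simp only [hcixx]
    simp [hpR]
  have key : ∀ n : ℕ, (b + x) ^ n = b ^ n + (∑ j ∈ Finset.range n, c ^ j) * x
      + ((∑ k ∈ Finset.range n, k : ℕ) : R) * (x * x) := by
    intro n
    induction n with
    | zero => simp
    | succ n ih =>
      have h1 : (∑ j ∈ Finset.range n, c ^ j) * (x * x) = n * (x * x) := by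
        rw [Finset.sum_mul]
        simp only [hcixx]
        simp
      rw [pow_succ, ih, Finset.sum_range_succ, Finset.sum_range_succ]
      simp only [add_mul, mul_add, mul_assoc, hxb, hbix, Nat.cast_add, h1]
      rw [← mul_assoc x x x, hxxx, pow_succ]
      simp only [mul_zero]
      abel
  have hs : ((∑ k ∈ Finset.range p, k : ℕ) : R) = 0 := by
    rw [Finset.sum_range_id]
    obtain ⟨m, rfl⟩ := hp
    have : (2 * m + 1) * (2 * m + 1 - 1) / 2 = (2 * m + 1) * m := by
      rw [Nat.add_sub_cancel, show (2 * m + 1) * (2 * m) = 2 * ((2 * m + 1) * m) by ring]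
      simp
    rw [this, Nat.cast_mul, hpR, zero_mul]
  rw [← hx, add_mul, one_mul, hxb, key, hs, hbp, zero_mul, add_zero]

/-- If `c` is central of order `p`, `b` has order `p` with `b ∉ ⟨c⟩`, and `a⁻¹ b a = b c`, then
`((1 + aB̂)b)^p = 1 + Ĉ(aB̂) ≠ 1`. -/
theorem one_add_aB_mul_b_pow_p (p : ℕ) [Fact p.Prime] (hp : Odd p)
    (F : Type*) [Field F] [CharP F p]
    (G : Type*) [Group G] [Finite G]
    (a b c : G) (hc : c ∈ Subgroup.center G)
    (hco : orderOf c = p) (hbo : orderOf b = p)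
    (hb : b ∉ Subgroup.zpowers c)
    (hab : a⁻¹ * b * a = b * c) :
    ((1 + MonoidAlgebra.of F G a * ∑ i ∈ Finset.range p, MonoidAlgebra.of F G (b ^ i)) *
        MonoidAlgebra.of F G b) ^ p =
      1 + (∑ j ∈ Finset.range p, MonoidAlgebra.of F G (c ^ j)) *
        (MonoidAlgebra.of F G a * ∑ i ∈ Finset.range p, MonoidAlgebra.of F G (b ^ i)) ∧
    ((1 + MonoidAlgebra.of F G a * ∑ i ∈ Finset.range p, MonoidAlgebra.of F G (b ^ i)) *
        MonoidAlgebra.of F G b) ^ p ≠ 1 := by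
  have hpp : p.Prime := Fact.out
  have hcomm : ∀ g : G, c * g = g * c := fun g => ((Subgroup.mem_center_iff.mp hc) g).symm
  have hba : b * a = a * b * c := by
    rw [mul_assoc, ← hab]; group
  have hpR : (p : MonoidAlgebra F G) = 0 := by
    rw [← map_natCast (algebraMap F (MonoidAlgebra F G)), CharP.cast_eq_zero, map_zero]
  have main := aux_ring_pow p hp hpR (MonoidAlgebra.of F G a) (MonoidAlgebra.of F G b)
    (MonoidAlgebra.of F G c) (by rw [← map_mul, ← map_mul, hcomm])
    (by rw [← map_mul, ← map_mul, hcomm])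
    (by rw [← map_pow, ← hco, pow_orderOf_eq_one, map_one])
    (by rw [← map_pow, ← hbo, pow_orderOf_eq_one, map_one])
    (by rw [← map_mul, ← map_mul, ← map_mul, hba])
  simp only [← map_pow] at main
  rw [main]
  refine ⟨rfl, fun h => ?_⟩
  rw [add_eq_left] at h
  have h2 := congrArg (fun y => (y : MonoidAlgebra F G).coeff a) h
  simp only [Finset.mul_sum, Finset.sum_mul, ← map_mul] at h2
  have key : ∀ i ∈ Finset.range p, ∀ j ∈ Finset.range p,
      c ^ j * (a * b ^ i) = a → i = 0 ∧ j = 0 := by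
    intro i hi j hj hij
    rw [Finset.mem_range] at hi hj
    have hcj : c ^ j * a = a * c ^ j := Commute.pow_left (hcomm a) j
    rw [← mul_assoc, hcj, mul_assoc, mul_eq_left] at hij
    have hi0 : i = 0 := by
      by_contra hne
      apply hb
      have hcop : (orderOf b).Coprime i := by
        rw [hbo]
        exact (Nat.Prime.coprime_iff_not_dvd hpp).mpr
          (fun hd => absurd (Nat.le_of_dvd (Nat.pos_of_ne_zero hne) hd) (by omega))
      have hmem : b ^ i ∈ Subgroup.zpowers c := by
        rw [eq_inv_of_mul_eq_one_right hij]
        exact inv_mem (pow_mem (Subgroup.mem_zpowers c) j)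
      obtain ⟨m, hm⟩ := exists_pow_eq_self_of_coprime hcop.symm
      rw [← hm]
      exact pow_mem hmem m
    refine ⟨hi0, ?_⟩
    rw [hi0, pow_zero, mul_one] at hij
    by_contra hne
    have := Nat.le_of_dvd (Nat.pos_of_ne_zero hne) (orderOf_dvd_of_pow_eq_one hij)
    omega
  classical
  have h3 : (∑ i ∈ Finset.range p, ∑ j ∈ Finset.range p,
      (MonoidAlgebra.of F G (c ^ j * (a * b ^ i))).coeff a : F) = 0 := by
    first
      | simpa [Finsupp.finset_sum_apply] using h2
      | (rw [Finset.sum_comm]; simpa [Finsupp.finset_sum_apply] using h2)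
  have h0 : (0 : ℕ) ∈ Finset.range p := Finset.mem_range.mpr hpp.pos
  rw [Finset.sum_eq_single_of_mem 0 h0, Finset.sum_eq_single_of_mem 0 h0] at h3
  · simp [MonoidAlgebra.of_apply, MonoidAlgebra.coeff_single, Finsupp.single_apply] at h3
  · intro j hj hne
    rw [MonoidAlgebra.of_apply, MonoidAlgebra.coeff_single, Finsupp.single_apply, if_neg]
    exact fun hh => hne (key 0 h0 j hj hh).2
  · intro i hi hne
    refine Finset.sum_eq_zero fun j hj => ?_
    rw [MonoidAlgebra.of_apply, MonoidAlgebra.coeff_single, Finsupp.single_apply, if_neg]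
    exact fun hh => hne (key i hi j hj hh).1
end

section
/- Let F be a field of characteristic 2, let m ≥ 1, and let G be a group containing elements a, b such that a has order 2^(m+1), b² = 1, and b⁻¹ab = a^(1+2^m). Then the element 1 + a + b is a unit in the group algebra FG. -/
open MonoidAlgebra

theorem aux_nilp {R : Type*} [Ring R] [CharP R 2] (A B Z : R) (m : ℕ)
    (hA : A ^ (2 ^ (m + 1)) = 1) (hB : B * B = 1) (hZ : Z * Z = 1)
    (hAZ : A * Z = Z * A) (hBZ : B * Z = Z * B) (hAB : A * B = B * A * Z) :
    IsNilpotent (A + B) := by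
  haveI : Fact (Nat.Prime 2) := ⟨Nat.prime_two⟩
  have hx : (A + B) ^ 2 = (A ^ 2 + 1) + B * A * (Z + 1) := by
    rw [sq, sq, add_mul, mul_add, mul_add, hAB, hB]; noncomm_ring
  have hA2B : A ^ 2 * B = B * A ^ 2 := by
    calc A ^ 2 * B = A * (A * B) := by rw [sq, mul_assoc]
      _ = (A * B) * (A * Z) := by rw [hAB]; simp only [mul_assoc]; rw [← mul_assoc A B, hAB]; simp only [mul_assoc]
      _ = B * A * (Z * (A * Z)) := by rw [hAB]; simp only [mul_assoc]
      _ = B * A * (A * (Z * Z)) := by rw [← mul_assoc Z, ← hAZ, mul_assoc A Z Z]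
      _ = B * A ^ 2 := by rw [hZ, mul_one, sq, mul_assoc]
  have cB : Commute (A ^ 2) B := hA2B
  have cA : Commute (A ^ 2) A := (Commute.refl A).pow_left 2
  have cZ : Commute (A ^ 2) Z := Commute.pow_left hAZ 2
  have cc : Commute (A ^ 2 + 1) (B * A * (Z + 1)) := by
    refine Commute.add_left ?_ (Commute.one_left _)
    exact (cB.mul_right cA).mul_right (cZ.add_right (Commute.one_right _))
  have n1 : IsNilpotent (A ^ 2 + 1) := by
    refine ⟨2 ^ m, ?_⟩
    rw [add_pow_char_pow_of_commute (p := 2) (h := Commute.one_right _), ← pow_mul, one_pow,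
      ← pow_succ', hA]
    exact CharTwo.add_self_eq_zero 1
  have cBAZ : Commute (B * A) (Z + 1) :=
    (Commute.mul_left hBZ hAZ).add_right (Commute.one_right _)
  have n2 : IsNilpotent (B * A * (Z + 1)) := by
    refine ⟨2, ?_⟩
    rw [cBAZ.mul_pow]
    have : (Z + 1) ^ 2 = 0 := by
      have h2 : (1 : R) + 1 = 0 := CharTwo.add_self_eq_zero 1
      have h3 : Z + Z = 0 := CharTwo.add_self_eq_zero Z
      calc (Z + 1) ^ 2 = Z * Z + 1 + (Z + Z) := by noncomm_ring
        _ = 0 := by rw [hZ, h2, h3, add_zero]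
    rw [this, mul_zero]
  have n := cc.isNilpotent_add n1 n2
  rw [← hx] at n
  obtain ⟨k, hk⟩ := n
  exact ⟨2 * k, by rw [pow_mul, hk]⟩

/-- If `char F = 2`, `m ≥ 1`, and `a, b ∈ G` satisfy the `M(2^(m+2))` relations with `a` of
exact order `2^(m+1)`, then `1 + a + b` is a unit of `FG`. -/
theorem one_add_a_add_b_isUnit
    (F : Type*) [Field F] [CharP F 2]
    (m : ℕ) (hm : 1 ≤ m)
    (G : Type*) [Group G] (a b : G)
    (ha : orderOf a = 2 ^ (m + 1)) (hb : b ^ 2 = 1)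
    (hab : b⁻¹ * a * b = a ^ (1 + 2 ^ m)) :
    IsUnit (1 + MonoidAlgebra.of F G a + MonoidAlgebra.of F G b) := by
  haveI : CharP (MonoidAlgebra F G) 2 :=
    charP_of_injective_algebraMap (algebraMap F (MonoidAlgebra F G)).injective 2
  have h1 : a ^ (2 ^ (m + 1)) = 1 := ha ▸ pow_orderOf_eq_one a
  have hz : a ^ (2 ^ m) * a ^ (2 ^ m) = 1 := by
    rw [← pow_add, ← two_mul, ← pow_succ', h1]
  have hab' : a * b = b * a * a ^ (2 ^ m) := by
    rw [mul_assoc, ← pow_succ', add_comm, ← hab]; group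
  have hbz : b * a ^ (2 ^ m) = a ^ (2 ^ m) * b := by
    have h : b⁻¹ * a ^ (2 ^ m) * b = a ^ (2 ^ m) := by
      have h2 : (b⁻¹ * a * b) ^ (2 ^ m) = b⁻¹ * a ^ (2 ^ m) * b := by
        simpa using conj_pow (a := b⁻¹) (b := a) (i := 2 ^ m)
      rw [← h2, hab, ← pow_mul, add_mul, one_mul, pow_add]
      obtain ⟨k, rfl⟩ : ∃ k, m = k + 1 := ⟨m - 1, by omega⟩
      have : 2 ^ (k + 1) * 2 ^ (k + 1) = 2 ^ (k + 1 + 1) * 2 ^ k := by ring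
      rw [this, pow_mul a (2 ^ (k + 1 + 1)), h1, one_pow, mul_one]
    nth_rewrite 1 [← h]; group
  rw [add_assoc]
  apply IsNilpotent.isUnit_one_add
  apply aux_nilp _ _ (MonoidAlgebra.of F G (a ^ (2 ^ m))) m
  · rw [← map_pow, h1, map_one]
  · rw [← map_mul, ← sq, hb, map_one]
  · rw [← map_mul, hz, map_one]
  · rw [← map_mul, ← map_mul, ← pow_succ', ← pow_succ]
  · rw [← map_mul, ← map_mul, hbz]
  · rw [← map_mul, ← map_mul, ← map_mul, hab']
end

section
/- Let F be a field of characteristic 2, let m ≥ 1, and let G be the group generated by elements a, b where a has order 2^(m+1), b has order 2, b⁻¹ab = a^(1+2^m), and b ∉ ⟨a⟩ (so G ≅ M(2^(m+2)) has order 2^(m+2)). Then in FG the group commutator (1 + a + b)⁻¹ a⁻¹ (1 + a + b) a of the units 1 + a + b and a does not lie in the F-linear span of the subgroup ⟨a⟩. -/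
open MonoidAlgebra

/-- Let `char F = 2`, `m ≥ 1` and let `G ≅ M(2^(m+2))` be generated by `a, b` with
`a` of order `2^(m+1)`, `b` of order `2`, `b⁻¹ a b = a^(1+2^m)` and `b ∉ ⟨a⟩`. Then the group
commutator `(1 + a + b)⁻¹ a⁻¹ (1 + a + b) a` in `(FG)ˣ` does not lie in the `F`-linear span
of `⟨a⟩` in `FG`. -/
theorem commutator_not_in_span
    (F : Type*) [Field F] [CharP F 2]
    (m : ℕ) (hm : 1 ≤ m)
    (G : Type*) [Group G] (a b : G)
    (hgen : Subgroup.closure {a, b} = ⊤)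
    (ha : orderOf a = 2 ^ (m + 1)) (hb : orderOf b = 2)
    (hab : b⁻¹ * a * b = a ^ (1 + 2 ^ m))
    (hba : b ∉ Subgroup.zpowers a) :
    ∀ w : MonoidAlgebra F G,
      w * (1 + MonoidAlgebra.of F G a + MonoidAlgebra.of F G b) = 1 →
      (1 + MonoidAlgebra.of F G a + MonoidAlgebra.of F G b) * w = 1 →
      w * MonoidAlgebra.of F G a⁻¹ *
          (1 + MonoidAlgebra.of F G a + MonoidAlgebra.of F G b) * MonoidAlgebra.of F G a ∉
        Submodule.span F (MonoidAlgebra.of F G '' (Subgroup.zpowers a : Set G)) := by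
  intro w _ hw2 hc
  set u := (1 + MonoidAlgebra.of F G a + MonoidAlgebra.of F G b) with hu
  set c := w * MonoidAlgebra.of F G a⁻¹ * u * MonoidAlgebra.of F G a with hcdef
  -- `c` is supported on `⟨a⟩`
  have hsupp : ∀ g : G, g ∉ Subgroup.zpowers a → c.coeff g = 0 := by
    intro g hg
    clear_value c
    clear hcdef
    induction hc using Submodule.span_induction with
    | mem x hx =>
      obtain ⟨h, hh, rfl⟩ := hx
      have hne : h ≠ g := by
        rintro rfl
        exact hg hh
      simp [MonoidAlgebra.of_apply, hne]
    | zero => simp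
    | add x y _ _ hx hy => simp [hx, hy]
    | smul r x _ hx => simp [hx]
  have key : u * c = 1 + MonoidAlgebra.of F G a + MonoidAlgebra.of F G (a⁻¹ * b * a) := by
    have h1 : u * c = MonoidAlgebra.of F G a⁻¹ * u * MonoidAlgebra.of F G a := by
      rw [hcdef]
      simp only [← mul_assoc]
      rw [hw2, one_mul]
    rw [h1, hu]
    simp only [mul_add, add_mul, mul_one, ← map_mul]
    simp [MonoidAlgebra.one_def]
  have hA : a ∈ Subgroup.zpowers a := Subgroup.mem_zpowers a
  have hA' : a⁻¹ ∈ Subgroup.zpowers a := inv_mem hA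
  have hb' : b⁻¹ ∉ Subgroup.zpowers a := by simpa using hba
  -- coefficient formula
  have coef : ∀ g : G, c.coeff g + c.coeff (a⁻¹ * g) + c.coeff (b⁻¹ * g) =
      (Finsupp.single 1 1 : G →₀ F) g + (Finsupp.single a 1 : G →₀ F) g
        + (Finsupp.single (a⁻¹ * b * a) 1 : G →₀ F) g := by
    intro g
    have h := congrArg (fun x : MonoidAlgebra F G => x.coeff g) key
    simpa [hu, add_mul, MonoidAlgebra.of_apply, MonoidAlgebra.one_def,
      MonoidAlgebra.coeff_single_mul_apply] using h
  have n1 : a⁻¹ * b ∉ Subgroup.zpowers a := by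
    rwa [Subgroup.mul_mem_cancel_left _ hA']
  have n2 : b * a⁻¹ ∉ Subgroup.zpowers a := by
    rwa [Subgroup.mul_mem_cancel_right _ hA']
  have n3 : a⁻¹ * (b * a⁻¹) ∉ Subgroup.zpowers a := by
    rwa [Subgroup.mul_mem_cancel_left _ hA']
  have n4 : a⁻¹ * b * a ∉ Subgroup.zpowers a := by
    rwa [Subgroup.mul_mem_cancel_right _ hA]
  have ne_of : ∀ x y : G, x ∈ Subgroup.zpowers a → y ∉ Subgroup.zpowers a → x ≠ y := by
    rintro x y hx hy rfl
    exact hy hx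
  have o : (1 : G) ∈ Subgroup.zpowers a := one_mem _
  have hm2 : 2 ≤ 2 ^ m := by
    calc 2 = 2 ^ 1 := rfl
      _ ≤ 2 ^ m := Nat.pow_le_pow_right (by norm_num) hm
  have hp : 2 ^ (m + 1) = 2 * 2 ^ m := by ring
  have e1 : a⁻¹ * b * a ≠ b := by
    intro h
    have h2 : a ^ (1 + 2 ^ m) = a ^ 1 := by
      rw [← hab, pow_one]
      have : b * a = a * b := by rw [mul_assoc, inv_mul_eq_iff_eq_mul] at h; exact h
      rw [mul_assoc, ← this]; group
    have h3 := pow_injOn_Iio_orderOf (x := a) (by simp [ha]; omega) (by simp [ha]) h2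
    omega
  have e2 : a⁻¹ * b * a ≠ b * a⁻¹ := by
    intro h
    have h2 : a ^ (1 + 2 ^ m) = a ^ 2 := by
      rw [← hab]
      have : a * b = b * a * a := by
        have h4 : b * a = a * (b * a⁻¹) := by rw [← h]; group
        rw [h4]; group
      rw [mul_assoc, this, pow_two]; group
    have h3 := pow_injOn_Iio_orderOf (x := a) (by simp [ha]; omega) (by simp [ha]; omega) h2
    have : 2 ∣ 2 ^ m := dvd_pow_self 2 (by omega)
    omega
  have ane : a ≠ 1 := by
    rintro rfl
    rw [orderOf_one] at ha
    omega
  have c1 := coef b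
  have c2 := coef (b * a⁻¹)
  have c3 := coef 1
  rw [hsupp _ hba, hsupp _ n1, inv_mul_cancel] at c1
  rw [hsupp _ n2, hsupp _ n3, inv_mul_cancel_left] at c2
  rw [mul_one, mul_one, hsupp _ hb'] at c3
  classical
  simp only [Finsupp.single_apply, if_neg e1, if_neg (ne_of _ _ o hba),
    if_neg (ne_of _ _ hA hba), zero_add, add_zero] at c1
  simp only [Finsupp.single_apply, if_neg e2, if_neg (ne_of _ _ o n2),
    if_neg (ne_of _ _ hA n2), zero_add, add_zero] at c2
  simp only [Finsupp.single_apply, if_neg ane, if_neg (ne_of _ _ o n4).symm, if_true,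
    zero_add, add_zero] at c3
  simp [c1, c2] at c3
end
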